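/- arXiv:0911.3682 — 2 statements merged into one kernel-verified Lean document; each statement's English description precedes it below -/
import Mathlib

section
/- The automorphism group of D₈ × C₂ (where D₈ is the dihedral group of order 16), a generalized dihedral group of order 32, is isomorphic to the holomorph Hol(C₈ × C₂). -/
/-- The holomorph of a group `G`: the semidirect product `G ⋊ Aut G`, where
`Aut G` acts on `G` in the natural way. -/
abbrev Hol (G : Type*) [Group G] : Type _ := G ⋊[MonoidHom.id (MulAut G)] MulAut G

namespace GenDihedral

/-- The action of `{1, -1}` on an abelian group in which `-1` acts by inversion. -/
def inversion (A : Type*) [CommGroup A] : ℤˣ →* MulAut A where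
  toFun u :=
    { toFun := fun a => a ^ (u : ℤ)
      invFun := fun a => a ^ (u : ℤ)
      left_inv := fun a => by simp [← zpow_mul]
      right_inv := fun a => by simp [← zpow_mul]
      map_mul' := fun a b => mul_zpow a b u }
  map_one' := by ext; simp
  map_mul' u v := by ext a; simp [mul_comm (u : ℤ), zpow_mul]

@[simp]
lemma inversion_apply {A : Type*} [CommGroup A] (u : ℤˣ) (a : A) : inversion A u a = a ^ (u : ℤ) := rfl

end GenDihedral

/-- The generalized dihedral group of an abelian group `A`: the semidirect product of `A` with
`{1, -1}`, where `-1` acts on `A` by inversion. -/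
abbrev GenDihedral (A : Type*) [CommGroup A] : Type _ :=
  A ⋊[GenDihedral.inversion A] ℤˣ

namespace GenDihedral

open SemidirectProduct

variable {A : Type*} [CommGroup A]

/-- The endomorphism of the generalized dihedral group that acts as `f.right` on `A` and sends the
reflection `(1, -1)` to `(f.left, -1)`. -/
def holEnd (f : Hol A) : GenDihedral A →* GenDihedral A where
  toFun g := ⟨f.right g.left * if g.right = 1 then 1 else f.left, g.right⟩
  map_one' := by ext <;> simp
  map_mul' g h := by
    ext
    · rcases Int.units_eq_one_or g.right with hg | hg <;>
      rcases Int.units_eq_one_or h.right with hh | hh <;>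
      simp [hg, hh, mul_comm, mul_left_comm, mul_assoc]
    · simp

lemma holEnd_apply (f : Hol A) (g : GenDihedral A) :
    holEnd f g = ⟨f.right g.left * if g.right = 1 then 1 else f.left, g.right⟩ := rfl

lemma holEnd_one : holEnd (1 : Hol A) = MonoidHom.id (GenDihedral A) := by
  refine MonoidHom.ext fun g => ?_
  ext <;> simp [holEnd_apply]

lemma holEnd_mul (f₁ f₂ : Hol A) : holEnd (f₁ * f₂) = (holEnd f₁).comp (holEnd f₂) := by
  refine MonoidHom.ext fun g => ?_
  ext
  · rcases Int.units_eq_one_or g.right with hg | hg <;>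
    simp [holEnd_apply, hg, mul_comm, mul_left_comm]
  · simp [holEnd_apply]

/-- The action of the holomorph of `A` on the generalized dihedral group of `A`. -/
def holToAut : Hol A →* MulAut (GenDihedral A) where
  toFun f := MonoidHom.toMulEquiv (holEnd f) (holEnd f⁻¹)
    (by rw [← holEnd_mul, inv_mul_cancel, holEnd_one])
    (by rw [← holEnd_mul, mul_inv_cancel, holEnd_one])
  map_one' := MulEquiv.ext fun g => DFunLike.congr_fun holEnd_one g
  map_mul' f₁ f₂ := MulEquiv.ext fun g => DFunLike.congr_fun (holEnd_mul f₁ f₂) g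

lemma holToAut_apply (f : Hol A) (g : GenDihedral A) :
    holToAut f g = ⟨f.right g.left * if g.right = 1 then 1 else f.left, g.right⟩ := rfl

lemma holToAut_injective : Function.Injective (holToAut (A := A)) := by
  intro f₁ f₂ h
  have key (g : GenDihedral A) := DFunLike.congr_fun h g
  simp only [holToAut_apply] at key
  ext a
  · simpa using key ⟨1, -1⟩
  · simpa using key ⟨a, 1⟩

/-- Every element outside the rotation subgroup is an involution. -/
lemma mul_self_of_right_ne_one {g : GenDihedral A} (hg : g.right ≠ 1) : g * g = 1 := by
  have hg' : g.right = -1 := (Int.units_eq_one_or _).resolve_left hg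
  ext <;> simp [hg']

/-- If `A` is not of exponent dividing two, then automorphisms of the generalized dihedral group
preserve the rotation subgroup. -/
lemma right_map_inl (hA : ∃ a : A, a * a ≠ 1) (φ : MulAut (GenDihedral A)) (a : A) :
    (φ (inl a)).right = 1 := by
  have square_ne (c : A) (hc : c * c ≠ 1) : (φ (inl c)).right = 1 := by
    by_contra hne
    have h := mul_self_of_right_ne_one hne
    rw [← map_mul, ← map_mul, map_eq_one_iff φ φ.injective,
      map_eq_one_iff _ inl_injective] at h
    exact hc h
  by_cases ha : a * a = 1
  · obtain ⟨c, hc⟩ := hA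
    have hac : a * c * (a * c) ≠ 1 := by rwa [mul_mul_mul_comm, ha, one_mul]
    simpa [square_ne c hc] using square_ne _ hac
  · exact square_ne a ha

/-- The restriction of an automorphism of the generalized dihedral group to `A`. -/
def restrict (hA : ∃ a : A, a * a ≠ 1) (φ : MulAut (GenDihedral A)) : A →* A where
  toFun a := (φ (inl a)).left
  map_one' := by simp
  map_mul' a b := by simp [right_map_inl hA]

lemma inl_restrict (hA : ∃ a : A, a * a ≠ 1) (φ : MulAut (GenDihedral A)) (a : A) :
    inl (restrict hA φ a) = φ (inl a) := by
  ext
  · rfl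
  · simp [right_map_inl hA]

lemma restrict_restrict_inv (hA : ∃ a : A, a * a ≠ 1) (φ : MulAut (GenDihedral A)) (a : A) :
    restrict hA φ (restrict hA φ⁻¹ a) = a := by
  apply inl_injective (φ := inversion A)
  rw [inl_restrict, inl_restrict, MulAut.apply_inv_self]

lemma holToAut_surjective (hA : ∃ a : A, a * a ≠ 1) :
    Function.Surjective (holToAut (A := A)) := by
  intro φ
  let α : MulAut A := (restrict hA φ).toMulEquiv (restrict hA φ⁻¹)
    (MonoidHom.ext fun a => by simpa using restrict_restrict_inv hA φ⁻¹ a)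
    (MonoidHom.ext fun a => restrict_restrict_inv hA φ a)
  have hα (a : A) : φ (inl a) = inl (α a) := (inl_restrict hA φ a).symm
  have hs : (φ (inr (-1))).right = -1 := by
    refine (Int.units_eq_one_or _).resolve_left fun h => ?_
    have hrot : φ (inr (-1)) = inl (φ (inr (-1))).left := by ext <;> simp [h]
    rw [← α.apply_symm_apply (φ (inr (-1))).left, ← hα] at hrot
    have := congrArg SemidirectProduct.right (φ.injective hrot)
    simp at this
  refine ⟨⟨(φ (inr (-1))).left, α⟩, MulEquiv.ext fun g => ?_⟩
  have hg : φ g = inl (α g.left) * φ (inr g.right) := by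
    rw [← hα, ← map_mul, inl_left_mul_inr_right]
  rw [hg, holToAut_apply]
  rcases Int.units_eq_one_or g.right with h | h <;> ext <;> simp [h, hs]

/-- If `A` is an abelian group that is not of exponent dividing two, then the automorphism group of
the generalized dihedral group of `A` is isomorphic to the holomorph of `A`. -/
noncomputable def autEquivHol (hA : ∃ a : A, a * a ≠ 1) : MulAut (GenDihedral A) ≃* Hol A :=
  (MulEquiv.ofBijective holToAut ⟨holToAut_injective, holToAut_surjective hA⟩).symm

/-- The direct product of a dihedral group with an elementary abelian two-group is a generalized
dihedral group. -/
def dihedralProdEquiv (n : ℕ) (C : Type*) [CommGroup C] (hC : ∀ c : C, c⁻¹ = c) :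
    DihedralGroup n × C ≃* GenDihedral (Multiplicative (ZMod n) × C) where
  toFun
    | (.r i, c) => ⟨(.ofAdd i, c), 1⟩
    | (.sr i, c) => ⟨(.ofAdd (-i), c), -1⟩
  invFun g :=
    (if g.right = 1 then .r g.left.1.toAdd else .sr (-g.left.1.toAdd), g.left.2)
  left_inv := by rintro ⟨_ | _, c⟩ <;> simp
  right_inv g := by
    rcases g with ⟨⟨i, c⟩, u⟩
    rcases Int.units_eq_one_or u with rfl | rfl <;> simp
  map_mul' := by
    rintro ⟨i | i, c⟩ ⟨j | j, d⟩ <;> ext <;> simp [hC, sub_eq_add_neg, mul_comm, add_comm]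

end GenDihedral

/-- The automorphism group of the generalized dihedral group `D₈ × C₂` of order 32
is isomorphic to the holomorph `Hol (C₈ × C₂)`. -/
theorem aut_D8xC2_iso_hol_C8xC2 :
    Nonempty
      (MulAut (DihedralGroup 8 × Multiplicative (ZMod 2)) ≃*
        Hol (Multiplicative (ZMod 8) × Multiplicative (ZMod 2))) :=
  ⟨(MulAut.congr (GenDihedral.dihedralProdEquiv 8 (Multiplicative (ZMod 2)) (by decide))).trans
    (GenDihedral.autEquivHol ⟨(.ofAdd 1, 1), by decide⟩)⟩
end

section
/- The automorphism group of A₄ × Q₈ (a group of order 96, where A₄ is the alternating group on 4 letters and Q₈ is the quaternion group of order 8) is isomorphic to S₄ × S₄. -/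
open Equiv QuaternionGroup

section Prod

variable {G H : Type*} [Group G] [Group H]

/-- A pair of automorphisms acts componentwise on the product. -/
def mulAutProdHom (G H : Type*) [Group G] [Group H] : MulAut G × MulAut H →* MulAut (G × H) where
  toFun p := MulEquiv.prodCongr p.1 p.2
  map_one' := rfl
  map_mul' _ _ := rfl

theorem mulAutProdHom_injective : Function.Injective (mulAutProdHom G H) := by
  rintro ⟨f, g⟩ ⟨f', g'⟩ h
  refine Prod.ext (MulEquiv.ext fun x => ?_) (MulEquiv.ext fun y => ?_)
  · exact congrArg Prod.fst (DFunLike.congr_fun h (x, 1))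
  · exact congrArg Prod.snd (DFunLike.congr_fun h (1, y))

/-- If `G` is finite and centerless and admits only the trivial homomorphism to the finite group
`H`, then every automorphism of `G × H` is componentwise. -/
theorem mulAutProdHom_surjective [Finite G] [Finite H] (hom : ∀ f : G →* H, f = 1)
    (hcenter : Subgroup.center G = ⊥) : Function.Surjective (mulAutProdHom G H) := by
  intro φ
  have snd_left (x : G) : (φ (x, 1)).2 = 1 :=
    DFunLike.congr_fun
      (hom (((MonoidHom.snd G H).comp φ.toMonoidHom).comp (MonoidHom.inl G H))) x
  let α : G →* G := ((MonoidHom.fst G H).comp φ.toMonoidHom).comp (MonoidHom.inl G H)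
  have hα (x : G) : φ (x, 1) = (α x, 1) := Prod.ext rfl (snd_left x)
  have α_inj : Function.Injective α := fun x y hxy => by
    have : φ (x, 1) = φ (y, 1) := by rw [hα, hα, hxy]
    exact congrArg Prod.fst (φ.injective this)
  have α_bij := Finite.injective_iff_bijective.mp α_inj
  have fst_right (y : H) : (φ (1, y)).1 = 1 := by
    rw [← Subgroup.mem_bot, ← hcenter, Subgroup.mem_center_iff]
    intro g
    obtain ⟨x, rfl⟩ := α_bij.surjective g
    have h : φ (x, 1) * φ (1, y) = φ (1, y) * φ (x, 1) := by simp [← map_mul]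
    exact congrArg Prod.fst h
  let δ : H →* H := ((MonoidHom.snd G H).comp φ.toMonoidHom).comp (MonoidHom.inr G H)
  have hδ (y : H) : φ (1, y) = (1, δ y) := Prod.ext (fst_right y) rfl
  have δ_inj : Function.Injective δ := fun x y hxy => by
    have : φ (1, x) = φ (1, y) := by rw [hδ, hδ, hxy]
    exact congrArg Prod.snd (φ.injective this)
  have δ_bij := Finite.injective_iff_bijective.mp δ_inj
  refine ⟨(MulEquiv.ofBijective α α_bij, MulEquiv.ofBijective δ δ_bij), ?_⟩
  ext1 ⟨x, y⟩
  have h : φ (x, y) = φ (x, 1) * φ (1, y) := by simp [← map_mul]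
  rw [h, hα, hδ]
  exact Prod.ext (mul_one (α x)).symm (one_mul (δ y)).symm

end Prod

section AlternatingGroupFour

/-- The 3-cycle `(0 1 2)` in `A₄`. -/
def threeCycle : alternatingGroup (Fin 4) := ⟨swap 0 1 * swap 1 2, Perm.mem_alternatingGroup.mpr (by decide)⟩

/-- The double transposition `(0 1)(2 3)` in `A₄`. -/
def doubleSwap : alternatingGroup (Fin 4) := ⟨swap 0 1 * swap 2 3, Perm.mem_alternatingGroup.mpr (by decide)⟩

theorem exists_eq_threeCycle_doubleSwap (x : alternatingGroup (Fin 4)) :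
    ∃ i j k : Fin 3,
      x = threeCycle ^ (i : ℕ) * doubleSwap ^ (j : ℕ) * threeCycle ^ (k : ℕ) := by
  revert x
  decide +kernel

set_option synthInstance.maxSize 512 in
theorem exists_conj_eq_of_relations :
    ∀ x y : Perm (Fin 4), x ^ 3 = 1 → y ^ 2 = 1 → (x * y) ^ 3 = 1 → x ≠ 1 → y ≠ 1 →
      ∃ g : Perm (Fin 4), g * threeCycle * g⁻¹ = x ∧ g * doubleSwap * g⁻¹ = y := by
  decide +kernel

theorem center_alternatingGroup_four : Subgroup.center (alternatingGroup (Fin 4)) = ⊥ := by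
  rw [eq_bot_iff]
  intro x hx
  rw [Subgroup.mem_center_iff] at hx
  have key : ∀ x : alternatingGroup (Fin 4), threeCycle * x = x * threeCycle →
      doubleSwap * x = x * doubleSwap → x = 1 := by decide +kernel
  exact key x (hx _) (hx _)

theorem conjNormal_alternatingGroup_four_bijective :
    Function.Bijective
      (MulAut.conjNormal : Perm (Fin 4) →* MulAut (alternatingGroup (Fin 4))) := by
  constructor
  · rw [injective_iff_map_eq_one]
    intro g hg
    have key : ∀ g : Perm (Fin 4), g * threeCycle * g⁻¹ = threeCycle →
        g * doubleSwap * g⁻¹ = doubleSwap → g = 1 := by decide +kernel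
    have fix (x : alternatingGroup (Fin 4)) : g * x * g⁻¹ = x := by
      rw [← MulAut.conjNormal_apply, hg, MulAut.one_apply]
    exact key g (fix _) (fix _)
  · intro f
    have pow_eq {n : ℕ} {x : alternatingGroup (Fin 4)} (h : x ^ n = 1) :
        (f x : Perm (Fin 4)) ^ n = 1 := by
      rw [← Subgroup.coe_pow, ← map_pow, h, map_one, Subgroup.coe_one]
    have ne_one {x : alternatingGroup (Fin 4)} (h : x ≠ 1) : (f x : Perm (Fin 4)) ≠ 1 := by
      simpa using h
    obtain ⟨g, hthree, hdouble⟩ := exists_conj_eq_of_relations (f threeCycle) (f doubleSwap)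
      (pow_eq (by decide +kernel)) (pow_eq (by decide +kernel))
      (by
        rw [← Subgroup.coe_mul, ← map_mul]
        exact pow_eq (by decide +kernel))
      (ne_one (by decide +kernel)) (ne_one (by decide +kernel))
    have conj_three : MulAut.conjNormal g threeCycle = f threeCycle := Subtype.ext hthree
    have conj_double : MulAut.conjNormal g doubleSwap = f doubleSwap := Subtype.ext hdouble
    refine ⟨g, MulEquiv.ext fun x => ?_⟩
    obtain ⟨i, j, k, rfl⟩ := exists_eq_threeCycle_doubleSwap x
    simp only [map_mul, map_pow, conj_three, conj_double]

end AlternatingGroupFour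

section QuaternionGroupTwo

/-- Label the long diagonals of a cube centered at the origin by `Fin 4`. For `p ≠ q`, this is the
unit quaternion along the axis through the midpoint of the edge joining suitably chosen ends of the
diagonals `p` and `q`; complementary pairs give inverse quaternions. -/
def diagonalPair : Fin 4 → Fin 4 → QuaternionGroup 2
  | 0, 1 | 1, 0 => a 1
  | 2, 3 | 3, 2 => a 3
  | 0, 2 | 2, 0 => xa 0
  | 1, 3 | 3, 1 => xa 2
  | 0, 3 | 3, 0 => xa 3
  | 1, 2 | 2, 1 => xa 1
  | _, _ => 1

/-- The action of a permutation of the diagonals, viewed as a rotation of the cube, on `Q₈`. -/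
def rotate (g : Perm (Fin 4)) : QuaternionGroup 2 → QuaternionGroup 2
  | a i => (diagonalPair (g 0) (g 1) ^ (Perm.sign g : ℤ)) ^ i.val
  | xa i => diagonalPair (g 0) (g 2) ^ (Perm.sign g : ℤ) *
      (diagonalPair (g 0) (g 1) ^ (Perm.sign g : ℤ)) ^ i.val

/-- `S₄` acts on `Q₈` by automorphisms through rotations of the cube. -/
abbrev rotationAction : MulDistribMulAction (Perm (Fin 4)) (QuaternionGroup 2) where
  smul := rotate
  one_smul := by
    change ∀ x, rotate 1 x = x
    decide +kernel
  mul_smul := by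
    change ∀ g h x, rotate (g * h) x = rotate g (rotate h x)
    decide +kernel
  smul_mul := by
    change ∀ g x y, rotate g (x * y) = rotate g x * rotate g y
    decide +kernel
  smul_one := by
    change ∀ g, rotate g 1 = 1
    decide +kernel

/-- The homomorphism `S₄ → Aut Q₈` given by rotations of the cube. -/
def rotationHom : Perm (Fin 4) →* MulAut (QuaternionGroup 2) :=
  letI := rotationAction
  MulDistribMulAction.toMulAut (Perm (Fin 4)) (QuaternionGroup 2)

theorem rotationHom_apply (g : Perm (Fin 4)) (x : QuaternionGroup 2) :
    rotationHom g x = rotate g x :=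
  rfl

theorem exists_eq_xa_zero_pow_mul_a_one_pow (x : QuaternionGroup 2) :
    ∃ i j : Fin 4, x = xa 0 ^ (i : ℕ) * a 1 ^ (j : ℕ) := by
  revert x
  decide +kernel

theorem exists_rotate_eq :
    ∀ x y : QuaternionGroup 2, x ^ 2 ≠ 1 → y ^ 2 ≠ 1 → x ≠ y → x ≠ y⁻¹ →
      ∃ g : Perm (Fin 4), rotate g (a 1) = x ∧ rotate g (xa 0) = y := by
  decide +kernel

theorem rotationHom_bijective : Function.Bijective rotationHom := by
  constructor
  · rw [injective_iff_map_eq_one]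
    intro g hg
    have key : ∀ g : Perm (Fin 4), rotate g (a 1) = a 1 → rotate g (xa 0) = xa 0 → g = 1 := by
      decide +kernel
    have fix (x : QuaternionGroup 2) : rotate g x = x := by
      rw [← rotationHom_apply, hg, MulAut.one_apply]
    exact key g (fix _) (fix _)
  · intro f
    obtain ⟨g, ha, hxa⟩ := exists_rotate_eq (f (a 1)) (f (xa 0))
      (by
        rw [← map_pow, Ne, map_eq_one_iff f f.injective]
        decide +kernel)
      (by
        rw [← map_pow, Ne, map_eq_one_iff f f.injective]
        decide +kernel)
      (f.injective.ne (by decide +kernel))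
      (by
        rw [← map_inv]
        exact f.injective.ne (by decide +kernel))
    rw [← rotationHom_apply] at ha hxa
    refine ⟨g, MulEquiv.ext fun x => ?_⟩
    obtain ⟨i, j, rfl⟩ := exists_eq_xa_zero_pow_mul_a_one_pow x
    simp only [map_mul, map_pow, ha, hxa]

end QuaternionGroupTwo

/-- `A₄` is generated by elements of order three, of which `Q₈` has none. -/
theorem alternatingGroup_four_hom_quaternionGroup_two_eq_one
    (f : alternatingGroup (Fin 4) →* QuaternionGroup 2) : f = 1 := by
  have no_cube_root : ∀ y : QuaternionGroup 2, y ^ 3 = 1 → y = 1 := by decide +kernel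
  have of_cube {x : alternatingGroup (Fin 4)} (h : x ^ 3 = 1) : f x = 1 :=
    no_cube_root _ (by rw [← map_pow, h, map_one])
  have hthree : f threeCycle = 1 := of_cube (by decide +kernel)
  have hdouble : f doubleSwap = 1 := by
    have h : f (threeCycle * doubleSwap) = 1 := of_cube (by decide +kernel)
    rwa [map_mul, hthree, one_mul] at h
  ext1 x
  obtain ⟨i, j, k, rfl⟩ := exists_eq_threeCycle_doubleSwap x
  simp [hthree, hdouble]

/-- The automorphism group of `A₄ × Q₈` (a group of order 96, where `Q₈` is the
quaternion group of order 8) is isomorphic to `S₄ × S₄`. -/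
theorem aut_A4xQ8_iso_S4xS4 :
    Nonempty
      (MulAut (↥(alternatingGroup (Fin 4)) × QuaternionGroup 2) ≃*
        Equiv.Perm (Fin 4) × Equiv.Perm (Fin 4)) := by
  have prod_bij : Function.Bijective
      (mulAutProdHom (alternatingGroup (Fin 4)) (QuaternionGroup 2)) :=
    ⟨mulAutProdHom_injective,
      mulAutProdHom_surjective alternatingGroup_four_hom_quaternionGroup_two_eq_one
        center_alternatingGroup_four⟩
  exact ⟨((MulEquiv.prodCongr
    (MulEquiv.ofBijective _ conjNormal_alternatingGroup_four_bijective)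
    (MulEquiv.ofBijective _ rotationHom_bijective)).trans
      (MulEquiv.ofBijective _ prod_bij)).symm⟩
end
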